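/- Suppose all the factor spaces H₁,…,Hₙ of H = H₁ ⊗ ⋯ ⊗ Hₙ (n > 1, each separable of dimension > 1) have the same Hilbert dimension, and that if n > 2 this common dimension is countably infinite. Then the set of hyperentangled unit vectors is norm dense in the unit sphere of H; moreover it contains a countable intersection of sets that are open and dense in the unit sphere of H. -/

import Mathlib

open scoped InnerProductSpace

noncomputable section

/-- The (completed) Hilbert tensor product `H = H₁ ⊗ ⋯ ⊗ Hₙ` of a finite family of complex
Hilbert spaces `Hs i`, presented as a Hilbert space `H` together with a multilinear map
`tmul` (elementary tensors) whose inner products multiply, whose elementary tensors span a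
dense subspace, and together with, for each factor `i`, the embedding
`A ↦ A ⊗ (identity on the other factors)` of the bounded operators on `Hs i`. -/
structure MultiTensor (ι : Type*) [Fintype ι] [DecidableEq ι] (Hs : ι → Type*) (H : Type*)
    [∀ i, NormedAddCommGroup (Hs i)] [∀ i, InnerProductSpace ℂ (Hs i)]
    [∀ i, CompleteSpace (Hs i)]
    [NormedAddCommGroup H] [InnerProductSpace ℂ H] [CompleteSpace H] where
  tmul : MultilinearMap ℂ Hs H
  inner_tmul : ∀ x y, ⟪tmul x, tmul y⟫_ℂ = ∏ i, ⟪x i, y i⟫_ℂ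
  dense_span : Dense (↑(Submodule.span ℂ (Set.range tmul)) : Set H)
  embed : ∀ i, (Hs i →L[ℂ] Hs i) → (H →L[ℂ] H)
  embed_tmul : ∀ i A x, embed i A (tmul x) = tmul (Function.update x i (A (x i)))

variable {ι : Type*} [Fintype ι] [DecidableEq ι] {Hs : ι → Type*} {H : Type*}
    [∀ i, NormedAddCommGroup (Hs i)] [∀ i, InnerProductSpace ℂ (Hs i)]
    [∀ i, CompleteSpace (Hs i)]
    [NormedAddCommGroup H] [InnerProductSpace ℂ H] [CompleteSpace H]

/-- The von Neumann algebra of the subsystem `S`: the double commutant (in the bounded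
operators on `H`) of the operators of the form `A ⊗ I` with `A` a bounded operator on a
factor `Hs i`, `i ∈ S`.  (It consists of the operators `B ⊗ I` with `B` bounded on `H_S`.) -/
def MultiTensor.alg (T : MultiTensor ι Hs H) (S : Set ι) : Set (H →L[ℂ] H) :=
  Set.centralizer (Set.centralizer (⋃ i ∈ S, Set.range (T.embed i)))

/-- An orthogonal projection on a Hilbert space: a self-adjoint idempotent bounded operator. -/
def IsONProj {E : Type*} [NormedAddCommGroup E] [InnerProductSpace ℂ E] [CompleteSpace E]
    (P : E →L[ℂ] E) : Prop :=
  IsSelfAdjoint P ∧ P ∘L P = P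

/-- The algebra of the subsystem `S` is maximally correlated with the algebra of the
subsystem `S'` in the state `v`: for every nonzero orthogonal projection `P'` of the algebra
of `S` and every `ε > 0` there is a nonzero orthogonal projection `P` of the algebra of `S'`
with `⟪v, P v⟫ > 0` and `⟪v, P' P v⟫ ≥ (1 - ε) ⟪v, P v⟫`. -/
def MultiTensor.MaxCorr (T : MultiTensor ι Hs H) (S S' : Set ι) (v : H) : Prop :=
  ∀ P' ∈ T.alg S, IsONProj P' → P' ≠ 0 → ∀ ε : ℝ, 0 < ε →
    ∃ P ∈ T.alg S', IsONProj P ∧ P ≠ 0 ∧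
      0 < (⟪v, P v⟫_ℂ).re ∧
      (1 - ε) * (⟪v, P v⟫_ℂ).re ≤ (⟪v, P' (P v)⟫_ℂ).re

/-- `v` is hyperentangled: for all disjoint nonempty subsystems `S`, `S'` of `{1,…,n}`, the
algebra of `S` is maximally correlated with the algebra of `S'` in `v`. -/
def MultiTensor.Hyper (T : MultiTensor ι Hs H) (v : H) : Prop :=
  ∀ S S' : Set ι, S.Nonempty → S'.Nonempty → Disjoint S S' → T.MaxCorr S S' v

open ContinuousLinearMap in
lemma IsONProj.re_inner_apply {E : Type*} [NormedAddCommGroup E] [InnerProductSpace ℂ E]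
    [CompleteSpace E] {P : E →L[ℂ] E} (hP : IsONProj P) (v : E) :
    (⟪v, P v⟫_ℂ).re = ‖P v‖ ^ 2 := by
  have h : P (P v) = P v := DFunLike.congr_fun hP.2 v
  have h2 := adjoint_inner_left P (P v) v
  rw [isSelfAdjoint_iff'.1 hP.1, h] at h2
  rw [← h2, inner_self_eq_norm_sq_to_K]
  norm_cast

namespace MultiTensor

open InnerProductSpace ContinuousLinearMap Topology

variable (T : MultiTensor ι Hs H)

lemma ext_tmul {K : Type*} [NormedAddCommGroup K] [NormedSpace ℂ K] {A B : H →L[ℂ] K}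
    (h : ∀ x, A (T.tmul x) = B (T.tmul x)) : A = B :=
  ContinuousLinearMap.ext_on T.dense_span (by rintro _ ⟨x, rfl⟩; exact h x)

lemma embed_comp (j : ι) (A B : Hs j →L[ℂ] Hs j) :
    T.embed j (A ∘L B) = T.embed j A ∘L T.embed j B :=
  T.ext_tmul fun x => by simp [T.embed_tmul]

lemma embed_smul (j : ι) (c : ℂ) (A : Hs j →L[ℂ] Hs j) :
    T.embed j (c • A) = c • T.embed j A :=
  T.ext_tmul fun x => by simp [T.embed_tmul]

lemma embed_add (j : ι) (A B : Hs j →L[ℂ] Hs j) :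
    T.embed j (A + B) = T.embed j A + T.embed j B :=
  T.ext_tmul fun x => by simp [T.embed_tmul]

lemma embed_adjoint (j : ι) (A : Hs j →L[ℂ] Hs j) :
    T.embed j (adjoint A) = adjoint (T.embed j A) := by
  refine T.ext_tmul fun x => ?_
  have h : innerSL ℂ (T.embed j (adjoint A) (T.tmul x)) =
      innerSL ℂ (adjoint (T.embed j A) (T.tmul x)) := by
    refine T.ext_tmul fun y => ?_
    rw [innerSL_apply_apply, innerSL_apply_apply, adjoint_inner_left, T.embed_tmul, T.embed_tmul,
      T.inner_tmul, T.inner_tmul]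
    refine Finset.prod_congr rfl fun i _ => ?_
    rcases eq_or_ne i j with rfl | hij
    · simp [adjoint_inner_left]
    · simp [hij]
  refine ext_inner_right ℂ fun z => ?_
  simpa using DFunLike.congr_fun h z

lemma embed_comm {i j : ι} (hij : i ≠ j) (A : Hs i →L[ℂ] Hs i) (B : Hs j →L[ℂ] Hs j) :
    T.embed i A * T.embed j B = T.embed j B * T.embed i A := by
  refine T.ext_tmul fun x => ?_
  simp [T.embed_tmul, hij, hij.symm, Function.update_comm hij]

lemma comm_of_mem_alg {S : Set ι} {P : H →L[ℂ] H} (hP : P ∈ T.alg S) {j : ι} (hj : j ∉ S)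
    (B : Hs j →L[ℂ] Hs j) (v : H) : P (T.embed j B v) = T.embed j B (P v) := by
  have h : T.embed j B ∈ Set.centralizer (⋃ i ∈ S, Set.range (T.embed i)) := by
    intro A hA
    simp only [Set.mem_iUnion, Set.mem_range] at hA
    obtain ⟨i, hi, A, rfl⟩ := hA
    exact T.embed_comm (by rintro rfl; exact hj hi) A B
  exact (DFunLike.congr_fun (hP _ h) v).symm

lemma embed_mem_alg {S : Set ι} {j : ι} (hj : j ∈ S) (B : Hs j →L[ℂ] Hs j) :
    T.embed j B ∈ T.alg S :=
  Set.subset_centralizer_centralizer (Set.mem_biUnion hj ⟨B, rfl⟩)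


lemma isONProj_embed_rankOne (j : ι) {y : Hs j} (hy : ‖y‖ = 1) :
    IsONProj (T.embed j (rankOne ℂ y y)) := by
  constructor
  · rw [isSelfAdjoint_iff', ← T.embed_adjoint, adjoint_rankOne]
  · rw [← T.embed_comp, rankOne_comp_rankOne]
    simp [hy]

/-- The vectors that the operators on the factor `j` carry `v` to are dense. -/
def Cyclic (j : ι) (v : H) : Prop :=
  Dense (Set.range fun A => T.embed j A v)

lemma norm_embed_rankOne_apply (j : ι) {e y : Hs j} (hy : ‖y‖ = 1) {z : H}
    (hz : T.embed j (rankOne ℂ e e) z = z) : ‖T.embed j (rankOne ℂ y e) z‖ = ‖z‖ := by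
  have h : (T.embed j (rankOne ℂ e y)) (T.embed j (rankOne ℂ y e) z) = z := by
    rw [← ContinuousLinearMap.comp_apply, ← T.embed_comp, rankOne_comp_rankOne]
    simpa [hy] using hz
  have h2 := adjoint_inner_left (T.embed j (rankOne ℂ y e)) z (T.embed j (rankOne ℂ y e) z)
  rw [← T.embed_adjoint, adjoint_rankOne, h, inner_self_eq_norm_sq_to_K,
    inner_self_eq_norm_sq_to_K] at h2
  have h3 : ‖T.embed j (rankOne ℂ y e) z‖ ^ 2 = ‖z‖ ^ 2 := by exact_mod_cast h2.symm
  exact (sq_eq_sq₀ (norm_nonneg _) (norm_nonneg _)).1 h3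

lemma tmul_eq_zero {x : ∀ i, Hs i} {j : ι} (h : x j = 0) : T.tmul x = 0 :=
  T.tmul.map_coord_zero j h

lemma Cyclic.maxCorr {j : ι} {v : H} (hv : T.Cyclic j v) {S S' : Set ι} (hS : j ∉ S)
    (hS' : j ∈ S') : T.MaxCorr S S' v := by
  intro P' hP'mem hP' hP'0 ε hε
  obtain ⟨x, hx⟩ : ∃ x, P' (T.tmul x) ≠ 0 := by
    by_contra! h
    exact hP'0 (T.ext_tmul fun x => by simpa using h x)
  have hxj : x j ≠ 0 := fun h => hx (by rw [T.tmul_eq_zero h, map_zero])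
  obtain ⟨e, he, hee⟩ : ∃ e : Hs j, ‖e‖ = 1 ∧ rankOne ℂ e e (x j) = x j := by
    have hn : ‖x j‖ ≠ 0 := norm_ne_zero_iff.2 hxj
    refine ⟨((‖x j‖⁻¹ : ℝ) : ℂ) • x j, ?_, ?_⟩
    · rw [norm_smul]; simp [hn]
    · have hn' : (‖x j‖ : ℂ) ≠ 0 := by exact_mod_cast hn
      rw [rankOne_apply, inner_smul_left, inner_self_eq_norm_sq_to_K, smul_smul]
      simp only [Complex.conj_ofReal, Complex.coe_algebraMap]
      push_cast
      rw [show (‖x j‖ : ℂ)⁻¹ * (‖x j‖ : ℂ) ^ 2 * (‖x j‖ : ℂ)⁻¹ = 1 by field_simp, one_smul]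
  set Q := T.embed j (rankOne ℂ e e) with hQ
  have hQw : Q (P' (T.tmul x)) = P' (T.tmul x) := by
    rw [hQ, ← T.comm_of_mem_alg hP'mem hS, T.embed_tmul, hee, Function.update_eq_self]
  have hP'w : P' (P' (T.tmul x)) = P' (T.tmul x) := DFunLike.congr_fun hP'.2 _
  obtain ⟨_, hB, B, rfl⟩ := hv.inter_open_nonempty
    {z : H | (1 - ε) * ‖Q z‖ ^ 2 < ‖P' (Q z)‖ ^ 2}
    (isOpen_lt (by fun_prop) (by fun_prop)) ⟨P' (T.tmul x), by
      rw [Set.mem_ofPred_eq, hQw, hP'w]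
      have := pow_pos (norm_pos_iff.2 hx) 2
      nlinarith⟩
  set u := Q (T.embed j B v) with hu
  replace hB : (1 - ε) * ‖u‖ ^ 2 < ‖P' u‖ ^ 2 := hB
  have hQu : Q u = u := DFunLike.congr_fun (T.isONProj_embed_rankOne j he).2 _
  have hQP'u : Q (P' u) = P' u := by
    rw [hQ, ← T.comm_of_mem_alg hP'mem hS, ← hQ, hQu]
  set y₀ := adjoint B e with hy₀
  have hu' : u = T.embed j (rankOne ℂ e y₀) v := by
    rw [hu, hQ, ← ContinuousLinearMap.comp_apply, ← T.embed_comp, rankOne_comp]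
  have hu0 : u ≠ 0 := by
    intro h
    simp [h] at hB
  have hy₀0 : y₀ ≠ 0 := by
    intro h
    apply hu0
    rw [hu', h, map_zero, ← zero_smul ℂ (0 : Hs j →L[ℂ] Hs j), T.embed_smul]
    simp
  have hn : ‖y₀‖ ≠ 0 := norm_ne_zero_iff.2 hy₀0
  set c : ℂ := ((‖y₀‖⁻¹ : ℝ) : ℂ) with hc
  have hc0 : 0 < ‖c‖ := by rw [hc]; simp [hy₀0]
  have hy : ‖c • y₀‖ = 1 := by rw [norm_smul, hc]; simp [hn]
  set y := c • y₀ with hyd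
  have hP := T.isONProj_embed_rankOne j hy
  have hPv : T.embed j (rankOne ℂ y y) v = c • T.embed j (rankOne ℂ y e) u := by
    rw [hu', ← ContinuousLinearMap.comp_apply, ← T.embed_comp, rankOne_comp_rankOne,
      inner_self_eq_norm_sq_to_K, he]
    have : rankOne ℂ y y = c • rankOne ℂ y y₀ := by
      ext z
      simp only [rankOne_apply, smul_apply]
      nth_rw 1 [hyd]
      rw [inner_smul_left, hc, Complex.conj_ofReal, mul_smul]
    rw [this, T.embed_smul]
    simp
  have hP'Pv : P' (T.embed j (rankOne ℂ y y) v) = c • T.embed j (rankOne ℂ y e) (P' u) := by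
    rw [hPv, map_smul, T.comm_of_mem_alg hP'mem hS]
  have hpos : 0 < (⟪v, T.embed j (rankOne ℂ y y) v⟫_ℂ).re := by
    rw [IsONProj.re_inner_apply hP, hPv, norm_smul, T.norm_embed_rankOne_apply j hy hQu]
    have := norm_pos_iff.2 hu0
    positivity
  refine ⟨_, T.embed_mem_alg hS' _, hP, fun h => by simp [h] at hpos, hpos, ?_⟩
  have hin : ⟪v, P' (T.embed j (rankOne ℂ y y) v)⟫_ℂ =
      ⟪T.embed j (rankOne ℂ y y) v, P' (T.embed j (rankOne ℂ y y) v)⟫_ℂ := by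
    have hPP : T.embed j (rankOne ℂ y y) (T.embed j (rankOne ℂ y y) v) =
      T.embed j (rankOne ℂ y y) v := DFunLike.congr_fun hP.2 v
    conv_lhs => rw [← hPP, T.comm_of_mem_alg hP'mem hS, ← adjoint_inner_left,
      isSelfAdjoint_iff'.1 hP.1]
  rw [hin, IsONProj.re_inner_apply hP, IsONProj.re_inner_apply hP', hP'Pv, hPv, norm_smul, norm_smul,
    T.norm_embed_rankOne_apply j hy hQu, T.norm_embed_rankOne_apply j hy hQP'u]
  have := pow_pos hc0 2
  nlinarith

lemma hyper_of_cyclic {v : H} (hv : ∀ j, T.Cyclic j v) : T.Hyper v := by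
  rintro S S' - ⟨j, hj⟩ hd
  exact (hv j).maxCorr T (fun h => Set.disjoint_left.1 hd h hj) hj

/-- A closed subspace that contains the products of basis vectors contains all elementary
tensors. -/
lemma tmul_mem_of_isClosed {J : Type*} (b : ∀ i, HilbertBasis J ℂ (Hs i)) (K : Submodule ℂ H)
    (hK : IsClosed (K : Set H)) (h : ∀ f : ι → J, T.tmul (fun i => b i (f i)) ∈ K)
    (x : ∀ i, Hs i) : T.tmul x ∈ K := by
  suffices H : ∀ (s : Finset ι) (x : ∀ i, Hs i), (∀ i ∉ s, x i ∈ Set.range (b i)) →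
      T.tmul x ∈ K from H Finset.univ x (by simp)
  intro s
  induction s using Finset.induction_on with
  | empty =>
    intro x hx
    choose f hf using fun i => hx i (by simp)
    simpa [hf] using h f
  | insert j s hj ih =>
    intro x hx
    let φ : Hs j →L[ℂ] H :=
      (T.tmul.mkContinuous 1 fun m => by
        have := T.inner_tmul m m
        simp only [inner_self_eq_norm_sq_to_K, Finset.prod_pow] at this
        have h2 : ‖T.tmul m‖ ^ 2 = (∏ i, ‖m i‖) ^ 2 := by exact_mod_cast this
        rw [one_mul, (sq_eq_sq₀ (norm_nonneg _) (by positivity)).1 h2]).toContinuousLinearMap x j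
    have hφ : ∀ z, φ z = T.tmul (Function.update x j z) := fun z => rfl
    have hle : Submodule.span ℂ (Set.range (b j)) ≤ K.comap (φ : Hs j →ₗ[ℂ] H) := by
      rw [Submodule.span_le]
      rintro _ ⟨k, rfl⟩
      change φ (b j k) ∈ K
      rw [hφ]
      refine ih _ fun i hi => ?_
      rcases eq_or_ne i j with rfl | hij
      · simp
      · simpa [hij] using hx i (by simp [hij, hi])
    have htop := Submodule.topologicalClosure_minimal _ hle (hK.preimage φ.continuous)
    rw [(b j).dense_span] at htop
    have : φ (x j) ∈ K := htop (Submodule.mem_top (x := x j))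
    rwa [hφ, Function.update_eq_self] at this

lemma dense_of_tmul_mem_closure {J : Type*} (b : ∀ i, HilbertBasis J ℂ (Hs i)) (K : Submodule ℂ H)
    (h : ∀ f : ι → J, T.tmul (fun i => b i (f i)) ∈ closure (K : Set H)) :
    Dense (K : Set H) := by
  have hle : Submodule.span ℂ (Set.range T.tmul) ≤ K.topologicalClosure := by
    rw [Submodule.span_le]
    rintro _ ⟨x, rfl⟩
    exact T.tmul_mem_of_isClosed b _ K.isClosed_topologicalClosure h x
  have := T.dense_span.mono hle
  rwa [Submodule.topologicalClosure_coe, dense_closure] at this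


/-- The embedding of the factor `j` into `H` given by a choice of basis vectors for the other
factors. -/
def fiber {J : Type*} (b : ∀ i, HilbertBasis J ℂ (Hs i)) (j : ι) (l : {i // i ≠ j} → J) :
    Hs j →ₗ[ℂ] H :=
  T.tmul.toLinearMap (fun i => if h : i = j then 0 else b i (l ⟨i, h⟩)) j

lemma embed_fiber {J : Type*} (b : ∀ i, HilbertBasis J ℂ (Hs i)) (j : ι)
    (l : {i // i ≠ j} → J) (A : Hs j →L[ℂ] Hs j) (x : Hs j) :
    T.embed j A (T.fiber b j l x) = T.fiber b j l (A x) := by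
  simp [fiber, T.embed_tmul]

lemma fiber_basis {J : Type*} (b : ∀ i, HilbertBasis J ℂ (Hs i)) (j : ι) (f : ι → J) :
    T.fiber b j (fun i => f i) (b j (f j)) = T.tmul fun i => b i (f i) := by
  simp only [fiber, MultilinearMap.toLinearMap_apply]
  congr 1
  ext1 i
  rcases eq_or_ne i j with rfl | h
  · simp
  · simp [h]

lemma frequently_isUnit_add_smul_one {L : Type*} [Fintype L] [DecidableEq L]
    (M : Matrix L L ℂ) : ∃ᶠ t in 𝓝 (0 : ℂ), IsUnit (M + t • (1 : Matrix L L ℂ)) := by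
  have hfin : (spectrum ℂ (-M)).Finite := Matrix.finite_spectrum _
  have hd : Dense (spectrum ℂ (-M))ᶜ := hfin.countable.dense_compl ℂ
  refine (mem_closure_iff_frequently.1 (hd 0)).mono fun t ht => ?_
  have := spectrum.notMem_iff.1 ht
  rwa [Algebra.algebraMap_eq_smul_one, sub_neg_eq_add, add_comm] at this

lemma exists_clm_map_eq {L : Type*} [Fintype L] [DecidableEq L] {E : Type*}
    [NormedAddCommGroup E] [InnerProductSpace ℂ E] (e u : L → E) (l₀ : L) (z : E)
    (h : IsUnit (Matrix.of fun l l' => ⟪e l, u l'⟫_ℂ)) :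
    ∃ A : E →L[ℂ] E, ∀ l, A (u l) = if l = l₀ then z else 0 := by
  obtain ⟨N, hN⟩ := h.exists_left_inv
  refine ⟨rankOne ℂ z (∑ l, star (N l₀ l) • e l), fun l => ?_⟩
  have := congrFun (congrFun hN l₀) l
  simp only [Matrix.mul_apply, Matrix.of_apply, Matrix.one_apply] at this
  rw [rankOne_apply, sum_inner]
  simp only [inner_smul_left, RCLike.star_def, Complex.conj_conj, this, eq_comm (a := l₀)]
  split_ifs <;> simp

lemma dense_exists_embed_apply_eq {J : Type*} (b : ∀ i, HilbertBasis J ℂ (Hs i)) (j : ι)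
    {φ : ({i // i ≠ j} → J) → J} (hφ : Function.Injective φ) (f : ι → J) :
    Dense {v : H | ∃ A, T.embed j A v = T.tmul fun i => b i (f i)} := by
  classical
  have hd : Dense (LinearMap.range (Finsupp.lsum ℂ (T.fiber b j)) : Set H) := by
    refine T.dense_of_tmul_mem_closure b _ fun f => subset_closure
      ⟨Finsupp.single (fun i => f i) (b j (f j)), ?_⟩
    rw [Finsupp.lsum_single, T.fiber_basis]
  rw [← dense_closure]
  refine hd.mono ?_
  rintro _ ⟨c, rfl⟩
  set l₀ : {i // i ≠ j} → J := fun i => f i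
  set L := insert l₀ c.support
  have hc : Finsupp.lsum ℂ (T.fiber b j) c = ∑ l : L, T.fiber b j l (c l) := by
    rw [Finsupp.lsum_apply, Finsupp.sum_of_support_subset c (Finset.subset_insert l₀ _) _ (by simp),
      Finset.sum_coe_sort L fun l => T.fiber b j l (c l)]
  let w : ℂ → H := fun t => ∑ l : L, T.fiber b j l (c l + t • b j (φ l))
  have hw : Continuous w := by
    simp only [w, map_add, map_smul]
    fun_prop
  have hw0 : w 0 = Finsupp.lsum ℂ (T.fiber b j) c := by simp [w, hc]
  rw [← hw0]
  refine mem_closure_iff_frequently.2 (hw.continuousAt.tendsto.frequently ?_)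
  refine (frequently_isUnit_add_smul_one
    (Matrix.of fun l l' : L => ⟪b j (φ l), c l'⟫_ℂ)).mono fun t ht => ?_
  obtain ⟨A, hA⟩ := exists_clm_map_eq (fun l : L => b j (φ l))
    (fun l : L => c l + t • b j (φ l)) ⟨l₀, Finset.mem_insert_self _ _⟩ (b j (f j)) (by
      convert ht using 1
      ext l l'
      have hite := orthonormal_iff_ite.1 (b j).orthonormal (φ l) (φ l')
      simp only [hφ.eq_iff, Subtype.val_inj] at hite
      simp [hite, Matrix.one_apply])
  refine ⟨A, ?_⟩
  simp only [w, map_sum, T.embed_fiber, hA]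
  rw [Finset.sum_eq_single ⟨l₀, Finset.mem_insert_self _ _⟩
    (fun l _ hl => by rw [if_neg hl, map_zero]) (by simp)]
  simpa using T.fiber_basis b j f

lemma dense_sphere_of_dense {E : Type*} [NormedAddCommGroup E] [NormedSpace ℂ E]
    {s : Set E} (hs : Dense s) (hsmul : ∀ v ∈ s, ∀ c : ℂ, c ≠ 0 → c • v ∈ s) :
    Dense {v : Metric.sphere (0 : E) 1 | (v : E) ∈ s} := by
  rw [Subtype.dense_iff]
  intro x hx
  have hx1 : ‖x‖ = 1 := by simpa using hx
  have ht : Filter.Tendsto (fun v : E => ((‖v‖⁻¹ : ℝ) : ℂ) • v) (𝓝 x) (𝓝 x) := by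
    have : ContinuousAt (fun v : E => ((‖v‖⁻¹ : ℝ) : ℂ) • v) x := by
      refine ContinuousAt.smul (Complex.continuous_ofReal.continuousAt.comp ?_) continuousAt_id
      exact continuous_norm.continuousAt.inv₀ (by simp [hx1])
    simpa [ContinuousAt, hx1] using this
  refine mem_closure_iff_frequently.2 (ht.frequently ?_)
  have hne : ∀ᶠ v in 𝓝 x, v ≠ 0 :=
    isOpen_ne.mem_nhds (by rintro rfl; simp at hx1)
  refine ((mem_closure_iff_frequently.1 (hs x)).and_eventually hne).mono ?_
  rintro v ⟨hv, hv0⟩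
  have hn : ‖v‖ ≠ 0 := norm_ne_zero_iff.2 hv0
  have hn' : ((‖v‖⁻¹ : ℝ) : ℂ) ≠ 0 := by exact_mod_cast inv_ne_zero hn
  exact ⟨⟨_, by simp [norm_smul, hn]⟩, hsmul v hv _ hn', rfl⟩

/-- The unit vectors that some operator on the factor `j` carries to within `δ` of `w`. -/
def nearSet (j : ι) (w : H) (δ : ℝ) : Set (Metric.sphere (0 : H) 1) :=
  {v | ∃ A, dist (T.embed j A v) w < δ}

lemma isOpen_nearSet (j : ι) (w : H) (δ : ℝ) : IsOpen (T.nearSet j w δ) := by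
  simp only [nearSet, Set.ofPred_exists]
  exact isOpen_iUnion fun A => isOpen_lt (by fun_prop) continuous_const

lemma dense_nearSet {J : Type*} (b : ∀ i, HilbertBasis J ℂ (Hs i)) (j : ι)
    {φ : ({i // i ≠ j} → J) → J} (hφ : Function.Injective φ) (f : ι → J) {δ : ℝ} (hδ : 0 < δ) :
    Dense (T.nearSet j (T.tmul fun i => b i (f i)) δ) := by
  refine (dense_sphere_of_dense (T.dense_exists_embed_apply_eq b j hφ f) ?_).mono ?_
  · rintro v ⟨A, hA⟩ c hc
    exact ⟨c⁻¹ • A, by simp [T.embed_smul, smul_smul, hc, hA]⟩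
  · rintro v ⟨A, hA⟩
    exact ⟨A, by simpa [hA] using hδ⟩

lemma cyclic_of_mem_nearSet {J : Type*} (b : ∀ i, HilbertBasis J ℂ (Hs i)) {j : ι}
    {v : Metric.sphere (0 : H) 1}
    (h : ∀ (f : ι → J) (n : ℕ), v ∈ T.nearSet j (T.tmul fun i => b i (f i)) (1 / (n + 1))) :
    T.Cyclic j v := by
  let F : (Hs j →L[ℂ] Hs j) →ₗ[ℂ] H :=
    { toFun := fun A => T.embed j A v
      map_add' := fun A B => by simp [T.embed_add]
      map_smul' := fun c A => by simp [T.embed_smul] }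
  have := T.dense_of_tmul_mem_closure b (LinearMap.range F) fun f => by
    refine Metric.mem_closure_iff.2 fun ε hε => ?_
    obtain ⟨n, hn⟩ := exists_nat_one_div_lt hε
    obtain ⟨A, hA⟩ := h f n
    exact ⟨_, ⟨A, rfl⟩, by rw [dist_comm]; exact hA.trans hn⟩
  exact this

lemma countable_of_hilbertBasis {J E : Type*} [NormedAddCommGroup E] [InnerProductSpace ℂ E]
    [TopologicalSpace.SeparableSpace E] (b : HilbertBasis J ℂ E) : Countable J := by
  refine Pairwise.countable_of_isOpen_disjoint (s := fun k => Metric.ball (b k) (1 / 2))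
    (fun k l hkl => ?_) (fun _ => Metric.isOpen_ball) (fun k => ⟨b k, by simp⟩)
  refine Metric.ball_disjoint_ball ?_
  have h : ‖b k - b l‖ ^ 2 = 2 := by
    rw [@norm_sub_sq ℂ, b.orthonormal.norm_eq_one, b.orthonormal.norm_eq_one,
      b.orthonormal.inner_eq_zero hkl]
    norm_num
  rw [dist_eq_norm]
  nlinarith [norm_nonneg (b k - b l)]

lemma exists_injective_of_card {J : Type*} [Countable J] (hn : 1 < Fintype.card ι)
    (hJ : 2 < Fintype.card ι → Infinite J) (j : ι) :
    ∃ φ : ({i // i ≠ j} → J) → J, Function.Injective φ := by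
  rcases Nat.lt_or_ge 2 (Fintype.card ι) with h | h
  · have := hJ h
    obtain ⟨g, hg⟩ := exists_injective_nat ({i // i ≠ j} → J)
    exact ⟨Infinite.natEmbedding J ∘ g, (Infinite.natEmbedding J).injective.comp hg⟩
  · have hc : Fintype.card {i // i ≠ j} = 1 := by
      rw [Fintype.card_subtype_compl, Fintype.card_subtype_eq]
      omega
    obtain ⟨i, hi⟩ := Fintype.card_eq_one_iff.1 hc
    exact ⟨fun l => l i, fun l l' hl => funext fun k => by rw [hi k]; exact hl⟩

end MultiTensor

/-- if all the factors of `H = H₁ ⊗ ⋯ ⊗ Hₙ` (`n > 1`, each separable of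
dimension `> 1`) have the same Hilbert dimension (expressed by the existence of orthonormal
bases indexed by a common type `J`), which is countably infinite when `n > 2`, then the set
of hyperentangled unit vectors is norm dense in the unit sphere of `H`; moreover it contains
a countable intersection of sets that are open and dense in the unit sphere. -/
theorem hyper_dense_in_unitSphere
    [∀ i, TopologicalSpace.SeparableSpace (Hs i)]
    (hn : 1 < Fintype.card ι) (hdim : ∀ i, 1 < Module.rank ℂ (Hs i))
    (T : MultiTensor ι Hs H)
    (hsamedim : ∃ (J : Type) (b : ∀ i, HilbertBasis J ℂ (Hs i)),
      2 < Fintype.card ι → Cardinal.mk J = Cardinal.aleph0) :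
    Dense {v : Metric.sphere (0 : H) 1 | T.Hyper ↑v} ∧
    ∃ g : ℕ → Set (Metric.sphere (0 : H) 1),
      (∀ n, IsOpen (g n)) ∧ (∀ n, Dense (g n)) ∧
      (⋂ n, g n) ⊆ {v : Metric.sphere (0 : H) 1 | T.Hyper ↑v} := by
  obtain ⟨J, b, hJ⟩ := hsamedim
  have : Nonempty ι := Fintype.card_pos_iff.1 (by omega)
  have hcount : Countable J := MultiTensor.countable_of_hilbertBasis (b (Classical.arbitrary ι))
  have hinj := MultiTensor.exists_injective_of_card hn
    fun h => Cardinal.infinite_iff.2 (hJ h).ge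
  have hne : Nonempty J := by
    by_contra hempty
    rw [not_nonempty_iff] at hempty
    have hi := hdim (Classical.arbitrary ι)
    have hsub : Subsingleton (Hs (Classical.arbitrary ι)) :=
      (b (Classical.arbitrary ι)).repr.injective.subsingleton
    rw [rank_subsingleton'] at hi
    exact absurd hi (by simp)
  obtain ⟨e, he⟩ := exists_surjective_nat (ι × (ι → J) × ℕ)
  let g : ℕ → Set (Metric.sphere (0 : H) 1) := fun n =>
    T.nearSet (e n).1 (T.tmul fun i => b i ((e n).2.1 i)) (1 / ((e n).2.2 + 1))
  have hopen : ∀ n, IsOpen (g n) := fun n => T.isOpen_nearSet _ _ _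
  have hdense : ∀ n, Dense (g n) := fun n => by
    obtain ⟨φ, hφ⟩ := hinj (e n).1
    exact T.dense_nearSet b _ hφ _ (by positivity)
  have hsub : (⋂ n, g n) ⊆ {v : Metric.sphere (0 : H) 1 | T.Hyper ↑v} := by
    intro v hv
    refine T.hyper_of_cyclic fun j => T.cyclic_of_mem_nearSet b fun f m => ?_
    obtain ⟨n, hn⟩ := he (j, f, m)
    simpa only [g, hn] using Set.mem_iInter.1 hv n
  have : CompleteSpace (Metric.sphere (0 : H) 1) :=
    Metric.isClosed_sphere.completeSpace_coe
  exact ⟨(dense_iInter_of_isOpen_nat hopen hdense).mono hsub, g, hopen, hdense, hsub⟩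

end
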